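/- arXiv:1306.6589 — 7 statements merged into one kernel-verified Lean document; each statement's English description precedes it below -/
import Mathlib

section
/- Let A be a Poisson algebra over a field F of characteristic 0, let θ_1,…,θ_m ∈ A be such that the m×m matrix C with entries C_{ij} = {θ_i,θ_j} is invertible in Mat_m(A), and let {·,·}^D be the Dirac bracket. Then the Dirac bracket satisfies the Jacobi identity: {a,{b,c}^D}^D − {b,{a,c}^D}^D = {{a,b}^D,c}^D for all a,b,c ∈ A. Consequently A, equipped with {·,·}^D, is again a Poisson algebra. -/
/-- The Dirac bracket satisfies the Jacobi identity; consequently `A` with the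
Dirac bracket is again a Poisson algebra (it is also skewsymmetric and
satisfies the Leibniz rule). -/
theorem dirac_bracket_jacobi
    {F : Type*} [Field F] [CharZero F]
    {A : Type*} [CommRing A] [Algebra F A]
    (B : A →ₗ[F] A →ₗ[F] A)
    (hskew : ∀ a b : A, B a b = - B b a)
    (hleib : ∀ a b c : A, B a (b * c) = b * B a c + c * B a b)
    (hjac : ∀ a b c : A, B a (B b c) - B b (B a c) = B (B a b) c)
    {m : ℕ} (θ : Fin m → A)
    (C Cinv : Matrix (Fin m) (Fin m) A)
    (hCdef : ∀ i j, C i j = B (θ i) (θ j))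
    (hinv₁ : C * Cinv = 1) (hinv₂ : Cinv * C = 1)
    (D : A → A → A)
    (hD : ∀ a b, D a b = B a b - ∑ i : Fin m, ∑ j : Fin m,
      B a (θ i) * Cinv i j * B (θ j) b) :
    (∀ a b c : A, D a (D b c) - D b (D a c) = D (D a b) c) ∧
    (∀ a b : A, D a b = - D b a) ∧
    (∀ a b c : A, D a (b * c) = b * D a c + c * D a b) := by
  have hleib' : ∀ a b c : A, B (a * b) c = a * B b c + b * B a c := fun a b c => by
    rw [hskew, hleib, hskew c b, hskew c a]; ring
  have hCskew : ∀ i j, C i j = - C j i := fun i j => by rw [hCdef, hCdef, hskew]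
  -- `a ↦ u a` gives the coefficients of the correction term in the Dirac bracket
  obtain ⟨u, hu⟩ : ∃ u : A → Fin m → A, ∀ a j, u a j = ∑ i, B a (θ i) * Cinv i j :=
    ⟨_, fun _ _ => rfl⟩
  have hDu : ∀ a b, D a b = B a b - ∑ j, u a j * B (θ j) b := fun a b => by
    rw [hD, Finset.sum_comm]
    simp only [hu, Finset.sum_mul]
  have huC : ∀ a k, ∑ j, u a j * C j k = B a (θ k) := fun a k => by
    have hvec : u a = Matrix.vecMul (fun i => B a (θ i)) Cinv := funext (hu a)
    change Matrix.vecMul (u a) C k = _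
    rw [hvec, Matrix.vecMul_vecMul, hinv₂, Matrix.vecMul_one]
  have hDθ : ∀ a k, D a (θ k) = 0 := fun a k => by
    rw [hDu, ← huC]
    simp only [hCdef, sub_self]
  have hDskew : ∀ a b : A, D a b = - D b a := by
    have key : ∀ a b, D a b = B a b + ∑ j, ∑ k, u a j * u b k * C k j := fun a b => by
      rw [hDu, sub_eq_add_neg, ← Finset.sum_neg_distrib]
      congr 1
      refine Finset.sum_congr rfl fun j _ => ?_
      rw [hskew (θ j) b, ← huC b j, mul_neg, neg_neg, Finset.mul_sum]
      exact Finset.sum_congr rfl fun k _ => by ring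
    intro a b
    rw [key, key, hskew a b, neg_add, Finset.sum_comm]
    simp only [← Finset.sum_neg_distrib]
    congr 1
    refine Finset.sum_congr rfl fun k _ => Finset.sum_congr rfl fun j _ => ?_
    rw [hCskew]; ring
  have hDleib : ∀ a b c : A, D a (b * c) = b * D a c + c * D a b := fun a b c => by
    simp only [hDu, hleib, mul_sub, Finset.mul_sum, mul_add, Finset.sum_add_distrib]
    simp only [mul_left_comm (u a _)]
    ring
  have hDsub : ∀ a b c, D a (b - c) = D a b - D a c := fun a b c => by
    simp only [hDu, map_sub, mul_sub, Finset.sum_sub_distrib]; ring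
  have hDzero : ∀ a, D a 0 = 0 := fun a => by simp [hDu]
  have hDsum : ∀ a (f : Fin m → A), D a (∑ k, f k) = ∑ k, D a (f k) := fun a f => by
    simp only [hDu, map_sum, Finset.mul_sum, Finset.sum_sub_distrib]
    rw [Finset.sum_comm]
  refine ⟨fun a b c => ?_, hDskew, hDleib⟩
  -- the Jacobiator in its last argument is a combination of the Hamiltonian derivations of `θ k`
  obtain ⟨e, he⟩ : ∃ e : Fin m → A, ∀ c,
      D a (D b c) - D b (D a c) - D (D a b) c = ∑ k, e k * B (θ k) c := by
    refine ⟨fun k => D b (u a k) - D a (u b k) + u (D a b) k, fun c => ?_⟩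
    have hexp : ∀ x y, D x (D y c) = B x (B y c) - ∑ j, u x j * B (θ j) (B y c)
        - ∑ k, u y k * B x (B (θ k) c) + ∑ k, ∑ j, u y k * (u x j * B (θ j) (B (θ k) c))
        - ∑ k, D x (u y k) * B (θ k) c := fun x y => by
      rw [hDu y c, hDsub, hDsum, hDu x (B y c)]
      simp only [hDleib]
      simp only [hDu x (B (θ _) c), mul_sub, Finset.sum_add_distrib, Finset.sum_sub_distrib,
        Finset.mul_sum, mul_comm (B (θ _) c)]
      ring
    have hham : B (D a b) c = B (B a b) c - ∑ j, u a j * B (B (θ j) b) c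
        - ∑ j, B (θ j) b * B (u a j) c := by
      rw [hDu a b]
      simp only [map_sub, map_sum, LinearMap.sub_apply, LinearMap.sum_apply, hleib',
        Finset.sum_add_distrib]
      ring
    have hdouble : ∑ k, u b k * B (B a (θ k)) c =
        ∑ k, ∑ j, u b k * (u a j * B (C j k) c) + ∑ j, B (θ j) b * B (u a j) c := by
      have hlast : ∀ j, B (θ j) b = ∑ k, u b k * C j k := fun j => by
        rw [hskew, ← huC, ← Finset.sum_neg_distrib]
        exact Finset.sum_congr rfl fun k _ => by rw [hCskew k j]; ring
      simp only [hlast, ← huC a, map_sum, LinearMap.sum_apply, hleib', Finset.mul_sum, mul_add,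
        Finset.sum_add_distrib, Finset.sum_mul]
      congr 1
      rw [Finset.sum_comm]
      exact Finset.sum_congr rfl fun _ _ => Finset.sum_congr rfl fun _ _ => by ring
    have hj₁ : ∑ j, u a j * B (B (θ j) b) c =
        ∑ j, u a j * B (θ j) (B b c) - ∑ j, u a j * B b (B (θ j) c) := by
      simp only [← hjac, mul_sub, Finset.sum_sub_distrib]
    have hj₂ : ∑ k, u b k * B (B a (θ k)) c =
        ∑ k, u b k * B a (B (θ k) c) - ∑ k, u b k * B (θ k) (B a c) := by
      simp only [← hjac, mul_sub, Finset.sum_sub_distrib]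
    have hj₃ : ∑ k, ∑ j, u b k * (u a j * B (C j k) c) =
        ∑ k, ∑ j, u b k * (u a j * B (θ j) (B (θ k) c))
          - ∑ k, ∑ j, u a k * (u b j * B (θ j) (B (θ k) c)) := by
      rw [Finset.sum_comm (f := fun k j => u a k * (u b j * B (θ j) (B (θ k) c)))]
      simp only [← Finset.sum_sub_distrib]
      refine Finset.sum_congr rfl fun k _ => Finset.sum_congr rfl fun j _ => ?_
      rw [hCdef, ← hjac]; ring
    simp only [add_mul, sub_mul, Finset.sum_add_distrib, Finset.sum_sub_distrib]
    rw [hexp, hexp, hDu (D a b) c, hham]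
    linear_combination hjac a b c + hj₁ + hj₂ - hj₃ - hdouble
  -- evaluating at the `θ l`, which are Casimirs, forces the coefficients to vanish
  have heC : Matrix.vecMul e C = 0 := funext fun l => by
    have h := he (θ l)
    simp only [hDθ, hDzero, sub_self, ← hCdef] at h
    exact h.symm
  have he0 : e = 0 := by
    rw [← Matrix.vecMul_one e, ← hinv₁, ← Matrix.vecMul_vecMul, heC, Matrix.zero_vecMul]
  have h := he c
  simp only [he0, Pi.zero_apply, zero_mul, Finset.sum_const_zero] at h
  exact sub_eq_zero.mp h
end

section
/- Let A be a Poisson algebra over a field F of characteristic 0, let θ_1,…,θ_m ∈ A be such that the m×m matrix C with entries C_{ij} = {θ_i,θ_j} is invertible in Mat_m(A), and let {·,·}^D be the Dirac bracket. Let I ⊆ A be the (associative algebra) ideal generated by θ_1,…,θ_m. Then I is a Poisson ideal for the Dirac bracket, i.e. {a,x}^D ∈ I and {x,a}^D ∈ I for every a ∈ A and x ∈ I; in particular the Dirac bracket descends to a well-defined bracket on the quotient algebra A/I. -/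
/-- An additive map on a commutative ring that satisfies the Leibniz rule and vanishes
on a set maps the ideal spanned by the set to itself. -/
theorem mem_span_of_leibniz {A : Type*} [CommRing A] {s : Set A} (d : A → A)
    (hadd : ∀ x y, d (x + y) = d x + d y) (hmul : ∀ x y, d (x * y) = x * d y + y * d x)
    (hs : ∀ x ∈ s, d x = 0) {x : A} (hx : x ∈ Ideal.span s) : d x ∈ Ideal.span s := by
  induction hx using Submodule.span_induction with
  | mem x h => rw [hs x h]; exact zero_mem _
  | zero =>
    have h := hadd 0 0
    rw [add_zero, left_eq_add] at h
    rw [h]; exact zero_mem _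
  | add x y _ _ hx hy => rw [hadd]; exact add_mem hx hy
  | smul r x hx h =>
    rw [smul_eq_mul, hmul]
    exact add_mem (Ideal.mul_mem_left _ r h) (Ideal.mul_mem_right _ _ hx)

/-- The ideal generated by the constraints is a Poisson ideal for the Dirac
bracket, and the Dirac bracket descends to the quotient algebra `A/I`. -/
theorem dirac_bracket_ideal
    {F : Type*} [Field F] [CharZero F]
    {A : Type*} [CommRing A] [Algebra F A]
    (B : A →ₗ[F] A →ₗ[F] A)
    (hskew : ∀ a b : A, B a b = - B b a)
    (hleib : ∀ a b c : A, B a (b * c) = b * B a c + c * B a b)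
    (hjac : ∀ a b c : A, B a (B b c) - B b (B a c) = B (B a b) c)
    {m : ℕ} (θ : Fin m → A)
    (C Cinv : Matrix (Fin m) (Fin m) A)
    (hCdef : ∀ i j, C i j = B (θ i) (θ j))
    (hinv₁ : C * Cinv = 1) (hinv₂ : Cinv * C = 1)
    (D : A → A → A)
    (hD : ∀ a b, D a b = B a b - ∑ i : Fin m, ∑ j : Fin m,
      B a (θ i) * Cinv i j * B (θ j) b)
    (I : Ideal A) (hI : I = Ideal.span (Set.range θ)) :
    (∀ (a x : A), x ∈ I → D a x ∈ I ∧ D x a ∈ I) ∧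
    (∃ Dbar : (A ⧸ I) → (A ⧸ I) → (A ⧸ I), ∀ a b : A,
      Dbar (Ideal.Quotient.mk I a) (Ideal.Quotient.mk I b)
        = Ideal.Quotient.mk I (D a b)) := by
  have hleib' : ∀ a b c : A, B (b * c) a = b * B c a + c * B b a := fun a b c => by
    rw [hskew, hleib, hskew a c, hskew a b]; ring
  have add_right : ∀ a x y, D a (x + y) = D a x + D a y := fun a x y => by
    simp only [hD, map_add, mul_add, Finset.sum_add_distrib]; ring
  have add_left : ∀ b x y, D (x + y) b = D x b + D y b := fun b x y => by
    simp only [hD, map_add, LinearMap.add_apply, add_mul, Finset.sum_add_distrib]; ring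
  have mul_right : ∀ a x y, D a (x * y) = x * D a y + y * D a x := fun a x y => by
    simp only [hD, hleib, mul_sub, Finset.mul_sum]
    rw [sub_add_sub_comm]
    simp only [← Finset.sum_add_distrib]
    congr 1
    exact Finset.sum_congr rfl fun i _ => Finset.sum_congr rfl fun j _ => by ring
  have mul_left : ∀ b x y, D (x * y) b = x * D y b + y * D x b := fun b x y => by
    simp only [hD, hleib', mul_sub, Finset.mul_sum]
    rw [sub_add_sub_comm]
    simp only [← Finset.sum_add_distrib]
    congr 1
    exact Finset.sum_congr rfl fun i _ => Finset.sum_congr rfl fun j _ => by ring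
  have theta_right : ∀ a k, D a (θ k) = 0 := fun a k => by
    have h : ∀ i, ∑ j, B a (θ i) * Cinv i j * B (θ j) (θ k)
        = B a (θ i) * (1 : Matrix (Fin m) (Fin m) A) i k := fun i => by
      simp only [← hinv₂, Matrix.mul_apply, Finset.mul_sum, hCdef, mul_assoc]
    simp [hD, h, Matrix.one_apply]
  have theta_left : ∀ b k, D (θ k) b = 0 := fun b k => by
    have h : ∀ j, ∑ i, B (θ k) (θ i) * Cinv i j * B (θ j) b
        = (1 : Matrix (Fin m) (Fin m) A) k j * B (θ j) b := fun j => by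
      simp only [← hinv₁, Matrix.mul_apply, Finset.sum_mul, hCdef]
    rw [hD, Finset.sum_comm]
    simp [h, Matrix.one_apply]
  have ideal : ∀ a x : A, x ∈ I → D a x ∈ I ∧ D x a ∈ I := by
    subst hI
    intro a x hx
    constructor
    · exact mem_span_of_leibniz (D a) (add_right a) (mul_right a)
        (by rintro _ ⟨k, rfl⟩; exact theta_right a k) hx
    · exact mem_span_of_leibniz (fun y => D y a) (add_left a) (mul_left a)
        (by rintro _ ⟨k, rfl⟩; exact theta_left a k) hx
  refine ⟨ideal, fun p q => Ideal.Quotient.mk I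
    (D (Function.surjInv Ideal.Quotient.mk_surjective p)
      (Function.surjInv Ideal.Quotient.mk_surjective q)), fun a b => ?_⟩
  have ha := Function.surjInv_eq Ideal.Quotient.mk_surjective (Ideal.Quotient.mk I a)
  have hb := Function.surjInv_eq Ideal.Quotient.mk_surjective (Ideal.Quotient.mk I b)
  set a' := Function.surjInv Ideal.Quotient.mk_surjective (Ideal.Quotient.mk I a)
  set b' := Function.surjInv Ideal.Quotient.mk_surjective (Ideal.Quotient.mk I b)
  rw [Ideal.Quotient.eq] at ha hb ⊢
  have h₁ := add_left b' (a' - a) a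
  have h₂ := add_right a (b' - b) b
  rw [sub_add_cancel] at h₁ h₂
  rw [h₁, h₂, ← add_assoc, add_sub_cancel_right]
  exact add_mem (ideal b' _ ha).2 (ideal a _ hb).1
end

section
/- Let A be a commutative associative unital algebra over a field F of characteristic 0 endowed with two compatible Poisson brackets {·,·}_0 and {·,·}_1. Let θ_1,…,θ_m ∈ A be central for the first bracket ({a,θ_k}_0 = 0 for all a ∈ A, k = 1,…,m), and suppose the m×m matrix C with entries C_{ij} = {θ_i,θ_j}_1 is invertible in Mat_m(A). Let {·,·}_1^D be the Dirac bracket of {·,·}_1 associated to θ_1,…,θ_m. Then {·,·}_0 and {·,·}_1^D are compatible Poisson brackets on A, i.e. for all a,b,c ∈ A: {a,{b,c}_1^D}_0 − {b,{a,c}_1^D}_0 − {{a,b}_0,c}_1^D + {a,{b,c}_0}_1^D − {b,{a,c}_0}_1^D − {{a,b}_1^D,c}_0 = 0. -/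
/-- An additive map satisfying the Leibniz rule that kills the entries of an invertible matrix
kills the entries of its inverse. -/
theorem Matrix.leibniz_inv_apply_eq_zero {A n : Type*} [CommRing A] [Fintype n] [DecidableEq n]
    (d : A →+ A) (hd : ∀ x y, d (x * y) = x * d y + y * d x) {C P : Matrix n n A}
    (hCP : C * P = 1) (hPC : P * C = 1) (hC : ∀ i j, d (C i j) = 0) (i j : n) :
    d (P i j) = 0 := by
  have hd1 : d 1 = 0 := by simpa using hd 1 1
  have hmap : C * P.map d = 0 := by
    ext i j
    have h := congrArg d (congrFun (congrFun hCP i) j)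
    have h1 : d ((1 : Matrix n n A) i j) = 0 := by
      by_cases hij : i = j <;> simp [Matrix.one_apply, hij, hd1]
    simpa [Matrix.mul_apply, map_sum, hd, hC, h1] using h
  have hP : P.map d = 0 := by
    rw [← Matrix.one_mul (P.map d), ← hPC, Matrix.mul_assoc, hmap, Matrix.mul_zero]
  exact congrFun (congrFun hP i) j

/-- The inverse of a skewsymmetric matrix is skewsymmetric. -/
theorem Matrix.transpose_inv_eq_neg {A n : Type*} [CommRing A] [Fintype n] [DecidableEq n]
    {C P : Matrix n n A} (hCP : C * P = 1) (hC : C.transpose = -C) :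
    P.transpose = -P := by
  have h : P.transpose * C = -1 := by
    have h := congrArg Matrix.transpose hCP
    rw [Matrix.transpose_mul, hC, Matrix.transpose_one, Matrix.mul_neg] at h
    rw [← h, neg_neg]
  rw [← Matrix.mul_one P.transpose, ← hCP, ← Matrix.mul_assoc, h, Matrix.neg_mul, Matrix.one_mul]


/-- If `{·,·}_0` and `{·,·}_1` are compatible Poisson brackets and the constraints
θ_1,…,θ_m are central for `{·,·}_0`, then `{·,·}_0` and the Dirac bracket
`{·,·}_1^D` are compatible Poisson brackets (mixed Jacobi identity). -/
theorem dirac_bracket_compatibility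
    {F : Type*} [Field F] [CharZero F]
    {A : Type*} [CommRing A] [Algebra F A]
    (B₀ B₁ : A →ₗ[F] A →ₗ[F] A)
    (hskew₀ : ∀ a b : A, B₀ a b = - B₀ b a)
    (hleib₀ : ∀ a b c : A, B₀ a (b * c) = b * B₀ a c + c * B₀ a b)
    (hjac₀ : ∀ a b c : A, B₀ a (B₀ b c) - B₀ b (B₀ a c) = B₀ (B₀ a b) c)
    (hskew₁ : ∀ a b : A, B₁ a b = - B₁ b a)
    (hleib₁ : ∀ a b c : A, B₁ a (b * c) = b * B₁ a c + c * B₁ a b)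
    (hjac₁ : ∀ a b c : A, B₁ a (B₁ b c) - B₁ b (B₁ a c) = B₁ (B₁ a b) c)
    (hcomp : ∀ a b c : A,
      B₀ a (B₁ b c) - B₀ b (B₁ a c) - B₁ (B₀ a b) c
      + B₁ a (B₀ b c) - B₁ b (B₀ a c) - B₀ (B₁ a b) c = 0)
    {m : ℕ} (θ : Fin m → A)
    (hcentral : ∀ (a : A) (k : Fin m), B₀ a (θ k) = 0)
    (C Cinv : Matrix (Fin m) (Fin m) A)
    (hCdef : ∀ i j, C i j = B₁ (θ i) (θ j))
    (hinv₁ : C * Cinv = 1) (hinv₂ : Cinv * C = 1)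
    (D : A → A → A)
    (hD : ∀ a b, D a b = B₁ a b - ∑ i : Fin m, ∑ j : Fin m,
      B₁ a (θ i) * Cinv i j * B₁ (θ j) b) :
    ∀ a b c : A,
      B₀ a (D b c) - B₀ b (D a c) - D (B₀ a b) c
      + D a (B₀ b c) - D b (B₀ a c) - B₀ (D a b) c = 0 := by
  intro a b c
  have hC (a : A) (i j : Fin m) : B₀ a (C i j) = 0 := by
    have h := hcomp a (θ i) (θ j)
    have hi (x : A) : B₀ (θ i) x = 0 := by rw [hskew₀, hcentral, neg_zero]
    simpa [hcentral, hi, ← hCdef] using h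
  have hP (a : A) (i j : Fin m) : B₀ a (Cinv i j) = 0 :=
    Matrix.leibniz_inv_apply_eq_zero (B₀ a).toAddMonoidHom (hleib₀ a) hinv₁ hinv₂ (hC a) i j
  have hPskew (i j : Fin m) : Cinv j i = -Cinv i j := by
    have hCt : C.transpose = -C := by
      ext i j
      simp only [Matrix.transpose_apply, Matrix.neg_apply, hCdef]
      exact hskew₁ _ _
    exact congrFun (congrFun (Matrix.transpose_inv_eq_neg hinv₁ hCt) i) j
  have hder (k : Fin m) (a b : A) :
      B₁ (θ k) (B₀ a b) = B₀ a (B₁ (θ k) b) - B₀ b (B₁ (θ k) a) := by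
    have h := hcomp a b (θ k)
    simp only [hcentral, map_zero, hskew₁ _ (θ k), map_neg] at h
    linear_combination h
  have hDsum (a b : A) : D a b = B₁ a b + ∑ i : Fin m, ∑ j : Fin m,
      Cinv i j * (B₁ (θ i) a * B₁ (θ j) b) := by
    rw [hD, sub_eq_add_neg, ← Finset.sum_neg_distrib]
    congr 1
    refine Finset.sum_congr rfl fun i _ => ?_
    rw [← Finset.sum_neg_distrib]
    refine Finset.sum_congr rfl fun j _ => ?_
    rw [hskew₁ a (θ i)]
    ring
  have hB₀D (x a b : A) : B₀ x (D a b) = B₀ x (B₁ a b) + ∑ i : Fin m, ∑ j : Fin m,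
      Cinv i j * (B₁ (θ i) a * B₀ x (B₁ (θ j) b) + B₁ (θ j) b * B₀ x (B₁ (θ i) a)) := by
    simp only [hDsum, map_add, map_sum, hleib₀, hP, mul_zero, add_zero]
  have hcancel : ∑ i : Fin m, ∑ j : Fin m, Cinv i j * (B₁ (θ i) b * B₀ c (B₁ (θ j) a)) +
      ∑ i : Fin m, ∑ j : Fin m, Cinv i j * (B₁ (θ j) b * B₀ c (B₁ (θ i) a)) = 0 := by
    rw [Finset.sum_comm, ← Finset.sum_add_distrib]
    refine Finset.sum_eq_zero fun i _ => ?_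
    rw [← Finset.sum_add_distrib]
    refine Finset.sum_eq_zero fun j _ => ?_
    rw [hPskew i j]
    ring
  have h := hcomp a b c
  rw [hskew₀ (B₁ a b) c] at h
  rw [hskew₀ (D a b) c, hB₀D, hB₀D, hB₀D, hDsum, hDsum, hDsum]
  simp only [hder, mul_add, mul_sub, sub_mul, Finset.sum_add_distrib, Finset.sum_sub_distrib]
    at hcancel ⊢
  simp only [mul_comm (B₀ _ (B₁ (θ _) _)) (B₁ (θ _) _)]
  linear_combination h + hcancel
end

section
/- Let A be a commutative associative unital algebra over a field F of characteristic 0 endowed with two compatible Poisson brackets {·,·}_0 and {·,·}_1, and let θ_1,…,θ_m ∈ A be central for the first bracket: {a,θ_k}_0 = 0 for all a ∈ A and k = 1,…,m. Then for all α,β ∈ {1,…,m} the element {θ_α,θ_β}_1 is central with respect to {·,·}_0, i.e. {a, {θ_α,θ_β}_1}_0 = 0 for all a ∈ A. -/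
/-- If θ_1,…,θ_m are central for `{·,·}_0` and the two Poisson brackets are
compatible, then each `{θ_α,θ_β}_1` is central with respect to `{·,·}_0`. -/
theorem bracket_of_constraints_central
    {F : Type*} [Field F] [CharZero F]
    {A : Type*} [CommRing A] [Algebra F A]
    (B₀ B₁ : A →ₗ[F] A →ₗ[F] A)
    (hskew₀ : ∀ a b : A, B₀ a b = - B₀ b a)
    (hleib₀ : ∀ a b c : A, B₀ a (b * c) = b * B₀ a c + c * B₀ a b)
    (hjac₀ : ∀ a b c : A, B₀ a (B₀ b c) - B₀ b (B₀ a c) = B₀ (B₀ a b) c)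
    (hskew₁ : ∀ a b : A, B₁ a b = - B₁ b a)
    (hleib₁ : ∀ a b c : A, B₁ a (b * c) = b * B₁ a c + c * B₁ a b)
    (hjac₁ : ∀ a b c : A, B₁ a (B₁ b c) - B₁ b (B₁ a c) = B₁ (B₁ a b) c)
    (hcomp : ∀ a b c : A,
      B₀ a (B₁ b c) - B₀ b (B₁ a c) - B₁ (B₀ a b) c
      + B₁ a (B₀ b c) - B₁ b (B₀ a c) - B₀ (B₁ a b) c = 0)
    {m : ℕ} (θ : Fin m → A)
    (hcentral : ∀ (a : A) (k : Fin m), B₀ a (θ k) = 0) :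
    ∀ (a : A) (α β : Fin m), B₀ a (B₁ (θ α) (θ β)) = 0 := by
  intro a α β
  have hcentral' (b : A) : B₀ (θ α) b = 0 := by
    rw [hskew₀, hcentral, neg_zero]
  simpa [hcentral, hcentral'] using hcomp a (θ α) (θ β)
end

section
/- Let S be a (not necessarily commutative) unital ring and R ⊆ S a subring. Let a, b, c ∈ R, assume b is invertible in S, and assume a and b are right coprime in the Bezout sense: there exist u, v ∈ R with u·a + v·b = 1. Then a·b^{-1}·c ∈ R if and only if b^{-1}·c ∈ R. -/
/-- If a, b ∈ R are right coprime (Bezout) elements of a subring R of a unital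
ring S, with b invertible in S, then for c ∈ R one has a·b⁻¹·c ∈ R iff b⁻¹·c ∈ R. -/
theorem coprime_fraction_lemma
    {S : Type*} [Ring S] (R : Subring S)
    (a b c binv u v : S)
    (ha : a ∈ R) (hb : b ∈ R) (hc : c ∈ R) (hu : u ∈ R) (hv : v ∈ R)
    (hb₁ : b * binv = 1) (hb₂ : binv * b = 1)
    (hbez : u * a + v * b = 1) :
    a * binv * c ∈ R ↔ binv * c ∈ R := by
  constructor
  · intro h
    have key : binv * c = u * (a * binv * c) + v * c := by
      calc binv * c = (u * a + v * b) * (binv * c) := by rw [hbez, one_mul]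
        _ = u * (a * binv * c) + v * (b * binv) * c := by
          simp only [add_mul, mul_assoc]
        _ = u * (a * binv * c) + v * c := by rw [hb₁, mul_one]
    rw [key]
    exact R.add_mem (R.mul_mem hu h) (R.mul_mem hv hc)
  · intro h
    rw [mul_assoc]
    exact R.mul_mem ha h
end

section
/- Let F be a field of characteristic 0, let R_ℓ = F[u_i^{(n)} : 1 ≤ i ≤ ℓ, n ∈ ℤ_{≥0}] be the algebra of differential polynomials with derivation ∂ determined by ∂(u_i^{(n)}) = u_i^{(n+1)}, let m ≤ ℓ, and let p_1,…,p_m ∈ R_ℓ be polynomials depending only on the variables u_i^{(n)} with 1 ≤ i ≤ ℓ−m (i.e. ∂p_α/∂u_{ℓ−m+β}^{(n)} = 0 for all α,β,n). For 1 ≤ i ≤ ℓ−m and s ∈ ℤ_{≥0} define the modified partial derivative ∂̃/∂̃u_i^{(s)} : R_ℓ → R_ℓ by (∂̃f/∂̃u_i^{(s)}) = ∂f/∂u_i^{(s)} − Σ_{α=1}^m Σ_{n≥0} (∂(∂^n p_α)/∂u_i^{(s)}) · (∂f/∂u_{ℓ−m+α}^{(n)}) (for each f only finitely many summands are nonzero).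 Then the operators ∂̃/∂̃u_i^{(s)}, for 1 ≤ i ≤ ℓ−m and s ∈ ℤ_{≥0}, are derivations of R_ℓ and pairwise commute: [∂̃/∂̃u_i^{(s)}, ∂̃/∂̃u_j^{(t)}] = 0 for all i,j ≤ ℓ−m and s,t ∈ ℤ_{≥0}. -/
open MvPolynomial

theorem MvPolynomial.pderiv_comm {σ R : Type*} [CommRing R] (a b : σ) (f : MvPolynomial σ R) :
    pderiv a (pderiv b f) = pderiv b (pderiv a f) := by
  classical
  have h : ⁅pderiv (R := R) a, pderiv (R := R) b⁆ = 0 := by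
    refine derivation_ext fun c => ?_
    simp [Derivation.commutator_apply, pderiv_X, Pi.single_apply, apply_ite]
  simpa [Derivation.commutator_apply, sub_eq_zero] using DFunLike.congr_fun h f

theorem MvPolynomial.finite_support_mul_pderiv {σ ι R : Type*} [CommSemiring R] {e : ι → σ}
    (he : Function.Injective e) (c : ι → MvPolynomial σ R) (f : MvPolynomial σ R) :
    (Function.support fun n => c n * pderiv (e n) f).Finite := by
  refine (f.vars.finite_toSet.preimage he.injOn).subset fun n hn => ?_
  by_contra h
  exact hn (by simp [pderiv_eq_zero_of_notMem_vars h])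

/-- The derivation `∑ n, c n • ∂/∂(e n)` for an injective family `e` of variables. -/
noncomputable def MvPolynomial.sumPDeriv {σ ι R : Type*} [CommRing R] {e : ι → σ}
    (he : Function.Injective e) (c : ι → MvPolynomial σ R) :
    Derivation R (MvPolynomial σ R) (MvPolynomial σ R) :=
  Derivation.mk'
    { toFun := fun f => ∑ᶠ n, c n * pderiv (e n) f
      map_add' := fun f g => by
        rw [← finsum_add_distrib (finite_support_mul_pderiv he c f)
          (finite_support_mul_pderiv he c g)]
        simp only [map_add, mul_add]
      map_smul' := fun r f => by
        rw [RingHom.id_apply, smul_finsum' _ (finite_support_mul_pderiv he c f)]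
        simp only [Derivation.map_smul, mul_smul_comm] }
    fun f g => by
      simp only [LinearMap.coe_mk, AddHom.coe_mk, smul_eq_mul]
      have hf := finite_support_mul_pderiv he (fun n => g * c n) f
      have hg := finite_support_mul_pderiv he (fun n => f * c n) g
      rw [mul_finsum' _ _ (finite_support_mul_pderiv he c f),
        mul_finsum' _ _ (finite_support_mul_pderiv he c g)]
      simp only [← mul_assoc]
      rw [← finsum_add_distrib hg hf]
      refine finsum_congr fun n => ?_
      rw [Derivation.leibniz, smul_eq_mul, smul_eq_mul]
      ring

theorem MvPolynomial.sumPDeriv_apply {σ ι R : Type*} [CommRing R] {e : ι → σ}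
    (he : Function.Injective e) (c : ι → MvPolynomial σ R) (f : MvPolynomial σ R) :
    sumPDeriv he c f = ∑ᶠ n, c n * pderiv (e n) f := rfl

/-- If `D` shifts the variables `(v, n) ↦ (v, n + 1)`, it preserves independence of the
variables `(v, n)`, `n ∈ ℕ`. -/
theorem MvPolynomial.pderiv_derivation_shift_eq_zero {ι R : Type*} [CommRing R]
    {D : Derivation R (MvPolynomial (ι × ℕ) R) (MvPolynomial (ι × ℕ) R)}
    (hD : ∀ v n, D (X (v, n)) = X (v, n + 1)) {v : ι} {f : MvPolynomial (ι × ℕ) R}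
    (hf : ∀ n, pderiv (v, n) f = 0) (n : ℕ) : pderiv (v, n) (D f) = 0 := by
  classical
  cases n with
  | zero =>
    have h : ⁅pderiv (R := R) (v, 0), D⁆ = 0 := by
      refine derivation_ext fun ⟨w, j⟩ => ?_
      simp [Derivation.commutator_apply, hD, pderiv_X, Pi.single_apply, apply_ite]
    simpa [Derivation.commutator_apply, hf] using DFunLike.congr_fun h f
  | succ n =>
    have h : ⁅pderiv (R := R) (v, n + 1), D⁆ = pderiv (v, n) := by
      refine derivation_ext fun ⟨w, j⟩ => ?_
      simp [Derivation.commutator_apply, hD, pderiv_X, Pi.single_apply, apply_ite]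
      grind
    simpa [Derivation.commutator_apply, hf] using DFunLike.congr_fun h f

theorem MvPolynomial.pderiv_iterate_derivation_shift_eq_zero {ι R : Type*} [CommRing R]
    {D : Derivation R (MvPolynomial (ι × ℕ) R) (MvPolynomial (ι × ℕ) R)}
    (hD : ∀ v n, D (X (v, n)) = X (v, n + 1)) {v : ι} {f : MvPolynomial (ι × ℕ) R}
    (hf : ∀ n, pderiv (v, n) f = 0) (k n : ℕ) : pderiv (v, n) (D^[k] f) = 0 := by
  induction k generalizing n with
  | zero => exact hf n
  | succ k ih =>
    rw [Function.iterate_succ_apply']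
    exact pderiv_derivation_shift_eq_zero hD ih n

/-- Differential polynomials in ℓ = k + m variables: the first k variables are
indexed by `Sum.inl i` (i : Fin k) and the last m variables (u_{ℓ−m+α}) by
`Sum.inr α` (α : Fin m). The modified partial derivatives
∂̃/∂̃u_i^{(s)} = ∂/∂u_i^{(s)} − Σ_α Σ_n ∂(∂ⁿp_α)/∂u_i^{(s)} · ∂/∂u_{ℓ−m+α}^{(n)}
are derivations and pairwise commute. -/
theorem modified_pderiv_derivations_commute
    {F : Type*} [Field F] [CharZero F] {k m : ℕ}
    (D : Derivation F (MvPolynomial ((Fin k ⊕ Fin m) × ℕ) F)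
      (MvPolynomial ((Fin k ⊕ Fin m) × ℕ) F))
    (hD : ∀ (v : Fin k ⊕ Fin m) (n : ℕ), D (X (v, n)) = X (v, n + 1))
    (p : Fin m → MvPolynomial ((Fin k ⊕ Fin m) × ℕ) F)
    (hp : ∀ (α β : Fin m) (n : ℕ), pderiv (Sum.inr β, n) (p α) = 0)
    (Dt : Fin k → ℕ → MvPolynomial ((Fin k ⊕ Fin m) × ℕ) F →
      MvPolynomial ((Fin k ⊕ Fin m) × ℕ) F)
    (hDt : ∀ i s f, Dt i s f = pderiv (Sum.inl i, s) f
      - ∑ α : Fin m, ∑ᶠ n : ℕ,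
          pderiv (Sum.inl i, s) ((⇑D)^[n] (p α)) * pderiv (Sum.inr α, n) f) :
    (∀ i s (f g : MvPolynomial ((Fin k ⊕ Fin m) × ℕ) F),
      Dt i s (f + g) = Dt i s f + Dt i s g) ∧
    (∀ i s (r : F) (f : MvPolynomial ((Fin k ⊕ Fin m) × ℕ) F),
      Dt i s (r • f) = r • Dt i s f) ∧
    (∀ i s (f g : MvPolynomial ((Fin k ⊕ Fin m) × ℕ) F),
      Dt i s (f * g) = f * Dt i s g + g * Dt i s f) ∧
    (∀ i j s t (f : MvPolynomial ((Fin k ⊕ Fin m) × ℕ) F),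
      Dt i s (Dt j t f) = Dt j t (Dt i s f)) := by
  classical
  have he (α : Fin m) : Function.Injective fun n : ℕ => ((Sum.inr α, n) : (Fin k ⊕ Fin m) × ℕ) :=
    fun a b h => (Prod.mk.inj h).2
  let E (i : Fin k) (s : ℕ) : Derivation F (MvPolynomial ((Fin k ⊕ Fin m) × ℕ) F)
      (MvPolynomial ((Fin k ⊕ Fin m) × ℕ) F) :=
    pderiv (Sum.inl i, s) -
      ∑ α, sumPDeriv (he α) fun n => pderiv (Sum.inl i, s) (D^[n] (p α))
  have hE (i s f) : Dt i s f = E i s f := by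
    rw [hDt, Derivation.sub_apply, ← Derivation.coeFnAddMonoidHom_apply (∑ α, _), map_sum,
      Finset.sum_apply]
    rfl
  have hE_of_indep (i s) {f : MvPolynomial ((Fin k ⊕ Fin m) × ℕ) F}
      (hf : ∀ α n, pderiv (Sum.inr α, n) f = 0) : E i s f = pderiv (Sum.inl i, s) f := by
    simp [← hE, hDt, hf]
  have hE_inl (i s j n) : E i s (X (Sum.inl j, n)) = if j = i ∧ n = s then 1 else 0 := by
    rw [hE_of_indep i s fun α n => pderiv_X_of_ne (by simp)]
    simp [pderiv_X, Pi.single_apply]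
  have hE_inr (i s α n) :
      E i s (X (Sum.inr α, n)) = -pderiv (Sum.inl i, s) (D^[n] (p α)) := by
    rw [← hE, hDt, pderiv_X_of_ne (by simp), zero_sub, Finset.sum_eq_single α,
      finsum_eq_single _ n]
    · simp
    · intro j hj
      simp [pderiv_X, hj.symm]
    · intro β _ hβ
      simp [pderiv_X, hβ.symm]
    · simp
  have hE_pderiv (i j s t α n) : E i s (pderiv (Sum.inl j, t) (D^[n] (p α))) =
      pderiv (Sum.inl i, s) (pderiv (Sum.inl j, t) (D^[n] (p α))) := by
    refine hE_of_indep i s fun β a => ?_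
    rw [pderiv_comm, pderiv_iterate_derivation_shift_eq_zero hD (hp α β), map_zero]
  have hcomm (i j s t) : ⁅E i s, E j t⁆ = 0 := by
    refine derivation_ext fun ⟨v, n⟩ => ?_
    rw [Derivation.commutator_apply]
    cases v with
    | inl a => simp [hE_inl, apply_ite]
    | inr α =>
      rw [hE_inr, hE_inr, map_neg, map_neg, hE_pderiv, hE_pderiv, pderiv_comm]
      simp
  simp only [hE]
  refine ⟨fun i s => map_add _, fun i s => Derivation.map_smul _, fun i s => Derivation.leibniz _,
    fun i j s t f => ?_⟩
  simpa [Derivation.commutator_apply, sub_eq_zero] using DFunLike.congr_fun (hcomm i j s t) f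
end

section
/- Let F be a field of characteristic 0, let R_ℓ = F[u_i^{(n)} : 1 ≤ i ≤ ℓ, n ∈ ℤ_{≥0}] be the algebra of differential polynomials with derivation ∂ determined by ∂(u_i^{(n)}) = u_i^{(n+1)}, let m ≤ ℓ, and let p_1,…,p_m ∈ R_ℓ depend only on the variables u_i^{(n)} with i ≤ ℓ−m. For h ∈ R_ℓ define the variational derivatives δh/δu_j = Σ_{s≥0} (−∂)^s(∂h/∂u_j^{(s)}) (finitely many nonzero terms) and the modified variational derivatives δ̃h/δ̃u_i = Σ_{s≥0} (−∂)^s(∂̃h/∂̃u_i^{(s)}) for 1 ≤ i ≤ ℓ−m, where ∂̃/∂̃u_i^{(s)} = ∂/∂u_i^{(s)} − Σ_{α=1}^m Σ_{n≥0} (∂(∂^n p_α)/∂u_i^{(s)}) · ∂/∂u_{ℓ−m+α}^{(n)}. Then for every h ∈ R_ℓ and every 1 ≤ i ≤ ℓ−m: δ̃h/δ̃u_i = δh/δu_i − Σ_{α=1}^m Σ_{s≥0} (−∂)^s( (∂p_α/∂u_i^{(s)}) · (δh/δu_{ℓ−m+α}) ). -/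
open MvPolynomial

section VariationalCalculus

variable {R ι : Type*} [CommRing R]

theorem finsum_eq_sum_range_of_forall_ge {M : Type*} [AddCommMonoid M] {f : ℕ → M} {N : ℕ}
    (hf : ∀ s, N ≤ s → f s = 0) : ∑ᶠ s, f s = ∑ s ∈ Finset.range N, f s := by
  refine finsum_eq_sum_of_support_subset f fun s hs => ?_
  by_contra hN
  exact hs (hf s (by simpa using hN))

theorem exists_forall_ge_pderiv_eq_zero (j : ι) (q : MvPolynomial (ι × ℕ) R) :
    ∃ N, ∀ s, N ≤ s → pderiv (j, s) q = 0 := by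
  classical
  refine ⟨(q.vars.image Prod.snd).sup id + 1, fun s hs => ?_⟩
  refine pderiv_eq_zero_of_notMem_vars fun hmem => ?_
  have : s ≤ (q.vars.image Prod.snd).sup id :=
    Finset.le_sup (f := id) (Finset.mem_image_of_mem Prod.snd hmem)
  omega

variable {D : Derivation R (MvPolynomial (ι × ℕ) R) (MvPolynomial (ι × ℕ) R)}

theorem iterate_neg_derivation (s : ℕ) (f : MvPolynomial (ι × ℕ) R) :
    (fun f => -(D f))^[s] f = ((-D.toLinearMap) ^ s) f := by
  rw [Module.End.pow_apply]
  rfl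

theorem pderiv_zero_derivation (hD : ∀ (j : ι) (n : ℕ), D (X (j, n)) = X (j, n + 1))
    (j : ι) (q : MvPolynomial (ι × ℕ) R) :
    pderiv (j, 0) (D q) = D (pderiv (j, 0) q) := by
  classical
  have : ⁅(pderiv (j, 0) : Derivation R (MvPolynomial (ι × ℕ) R) _), D⁆ = 0 := by
    refine derivation_ext fun ⟨i, n⟩ => ?_
    simp [Derivation.commutator_apply, hD, pderiv_X, Pi.single_apply, apply_ite D]
  have hq := congrArg (fun d => d q) this
  simpa [Derivation.commutator_apply, sub_eq_zero] using hq

theorem pderiv_succ_derivation (hD : ∀ (j : ι) (n : ℕ), D (X (j, n)) = X (j, n + 1))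
    (j : ι) (s : ℕ) (q : MvPolynomial (ι × ℕ) R) :
    pderiv (j, s + 1) (D q) = D (pderiv (j, s + 1) q) + pderiv (j, s) q := by
  classical
  have : ⁅(pderiv (j, s + 1) : Derivation R (MvPolynomial (ι × ℕ) R) _), D⁆ = pderiv (j, s) := by
    refine derivation_ext fun ⟨i, n⟩ => ?_
    simp [Derivation.commutator_apply, hD, pderiv_X, Pi.single_apply, apply_ite D]
  have hq := congrArg (fun d => d q) this
  rw [← hq]
  simp [Derivation.commutator_apply]

theorem exists_forall_ge_pow_pderiv_mul_eq_zero (j : ι) (q g : MvPolynomial (ι × ℕ) R) :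
    ∃ N, ∀ s, N ≤ s → ((-D.toLinearMap) ^ s) (pderiv (j, s) q * g) = 0 := by
  obtain ⟨N, hN⟩ := exists_forall_ge_pderiv_eq_zero j q
  exact ⟨N, fun s hs => by simp [hN s hs]⟩

theorem finite_support_pow_pderiv_mul (j : ι) (q g : MvPolynomial (ι × ℕ) R) :
    (Function.support fun s => ((-D.toLinearMap) ^ s) (pderiv (j, s) q * g)).Finite := by
  obtain ⟨N, hN⟩ := exists_forall_ge_pow_pderiv_mul_eq_zero (D := D) j q g
  refine (Set.finite_lt_nat N).subset fun s hs => ?_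
  by_contra h
  exact hs (hN s (not_lt.mp h))

/-- The adjoint of the Fréchet derivative of `D q` is that of `q` composed with `-D`. -/
theorem finsum_pow_pderiv_derivation_mul
    (hD : ∀ (j : ι) (n : ℕ), D (X (j, n)) = X (j, n + 1))
    (j : ι) (q g : MvPolynomial (ι × ℕ) R) :
    ∑ᶠ s, ((-D.toLinearMap) ^ s) (pderiv (j, s) (D q) * g)
      = ∑ᶠ s, ((-D.toLinearMap) ^ s) (pderiv (j, s) q * (-D.toLinearMap) g) := by
  obtain ⟨N, hN⟩ := exists_forall_ge_pderiv_eq_zero j q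
  rw [finsum_eq_sum_range_of_forall_ge (N := N + 1), finsum_eq_sum_range_of_forall_ge (N := N + 1)]
  · have hmul : ∀ s, pderiv (j, s) q * (-D.toLinearMap) g
        = D (pderiv (j, s) q) * g + (-D.toLinearMap) (pderiv (j, s) q * g) := by
      intro s
      simp
      ring
    simp only [hmul, map_add, Finset.sum_add_distrib]
    rw [Finset.sum_range_succ', Finset.sum_range_succ' (fun s => ((-D.toLinearMap) ^ s) (D (pderiv (j, s) q) * g)),
      Finset.sum_range_succ (fun s => ((-D.toLinearMap) ^ s) ((-D.toLinearMap) (pderiv (j, s) q * g)))]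
    simp only [pderiv_succ_derivation hD, pderiv_zero_derivation hD, add_mul, map_add,
      Finset.sum_add_distrib, hN N le_rfl, zero_mul, map_zero, add_zero, pow_succ,
      Module.End.mul_apply]
    abel
  · intro s hs
    simp [hN s (by omega)]
  · rintro (_ | s) hs
    · omega
    · simp [pderiv_succ_derivation hD, hN s (by omega), hN (s + 1) (by omega)]

theorem finsum_pow_pderiv_iterate_mul
    (hD : ∀ (j : ι) (n : ℕ), D (X (j, n)) = X (j, n + 1))
    (j : ι) (n : ℕ) (q g : MvPolynomial (ι × ℕ) R) :
    ∑ᶠ s, ((-D.toLinearMap) ^ s) (pderiv (j, s) (D^[n] q) * g)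
      = ∑ᶠ s, ((-D.toLinearMap) ^ s) (pderiv (j, s) q * ((-D.toLinearMap) ^ n) g) := by
  induction n generalizing g with
  | zero => simp
  | succ n ih =>
    rw [Function.iterate_succ_apply', finsum_pow_pderiv_derivation_mul hD, ih, pow_succ,
      Module.End.mul_apply]

end VariationalCalculus


open MvPolynomial

/-- Formula for the modified variational derivative:
δ̃h/δ̃u_i = δh/δu_i − Σ_α Σ_s (−∂)^s( (∂p_α/∂u_i^{(s)}) · (δh/δu_{ℓ−m+α}) ). -/
theorem modified_variational_derivative_formula
    {F : Type*} [Field F] [CharZero F] {k m : ℕ}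
    (D : Derivation F (MvPolynomial ((Fin k ⊕ Fin m) × ℕ) F)
      (MvPolynomial ((Fin k ⊕ Fin m) × ℕ) F))
    (hD : ∀ (v : Fin k ⊕ Fin m) (n : ℕ), D (X (v, n)) = X (v, n + 1))
    (p : Fin m → MvPolynomial ((Fin k ⊕ Fin m) × ℕ) F)
    (hp : ∀ (α β : Fin m) (n : ℕ), pderiv (Sum.inr β, n) (p α) = 0)
    (Dt : Fin k → ℕ → MvPolynomial ((Fin k ⊕ Fin m) × ℕ) F →
      MvPolynomial ((Fin k ⊕ Fin m) × ℕ) F)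
    (hDt : ∀ i s f, Dt i s f = pderiv (Sum.inl i, s) f
      - ∑ α : Fin m, ∑ᶠ n : ℕ,
          pderiv (Sum.inl i, s) ((⇑D)^[n] (p α)) * pderiv (Sum.inr α, n) f)
    (varD : (Fin k ⊕ Fin m) → MvPolynomial ((Fin k ⊕ Fin m) × ℕ) F →
      MvPolynomial ((Fin k ⊕ Fin m) × ℕ) F)
    (hvarD : ∀ j h, varD j h
      = ∑ᶠ s : ℕ, (fun f => -(D f))^[s] (pderiv (j, s) h))
    (varDt : Fin k → MvPolynomial ((Fin k ⊕ Fin m) × ℕ) F →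
      MvPolynomial ((Fin k ⊕ Fin m) × ℕ) F)
    (hvarDt : ∀ i h, varDt i h = ∑ᶠ s : ℕ, (fun f => -(D f))^[s] (Dt i s h)) :
    ∀ (h : MvPolynomial ((Fin k ⊕ Fin m) × ℕ) F) (i : Fin k),
      varDt i h = varD (Sum.inl i) h
        - ∑ α : Fin m, ∑ᶠ s : ℕ, (fun f => -(D f))^[s]
            (pderiv (Sum.inl i, s) (p α) * varD (Sum.inr α) h) := by
  intro h i
  have hbound : ∃ N, ∀ α : Fin m, ∀ n, N ≤ n → pderiv (Sum.inr α, n) h = 0 := by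
    choose N hN using fun α : Fin m =>
      exists_forall_ge_pderiv_eq_zero (Sum.inr α : Fin k ⊕ Fin m) h
    exact ⟨Finset.univ.sup N, fun α n hn =>
      hN α n ((Finset.le_sup (Finset.mem_univ α)).trans hn)⟩
  obtain ⟨N, hN⟩ := hbound
  have hvar : ∀ α, varD (Sum.inr α) h
      = ∑ n ∈ Finset.range N, ((-D.toLinearMap) ^ n) (pderiv (Sum.inr α, n) h) := by
    intro α
    rw [hvarD]
    simp only [iterate_neg_derivation]
    exact finsum_eq_sum_range_of_forall_ge fun n hn => by simp [hN α n hn]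
  have hDt' : ∀ s, Dt i s h = pderiv (Sum.inl i, s) h - ∑ α : Fin m, ∑ n ∈ Finset.range N,
      pderiv (Sum.inl i, s) (D^[n] (p α)) * pderiv (Sum.inr α, n) h := by
    intro s
    rw [hDt]
    congr 1
    exact Finset.sum_congr rfl fun α _ =>
      finsum_eq_sum_range_of_forall_ge fun n hn => by simp [hN α n hn]
  have hfin := finite_support_pow_pderiv_mul (D := D) (Sum.inl i : Fin k ⊕ Fin m)
  have hfin_sum : ∀ α, (Function.support fun s => ∑ n ∈ Finset.range N, ((-D.toLinearMap) ^ s)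
      (pderiv (Sum.inl i, s) (D^[n] (p α)) * pderiv (Sum.inr α, n) h)).Finite := fun α =>
    Function.HasFiniteSupport.sum (fun n => hfin _ _) _
  have hfin_sum_sum := Function.HasFiniteSupport.sum hfin_sum Finset.univ
  have hfin_h := hfin h 1
  simp only [mul_one] at hfin_h
  rw [hvarDt, hvarD]
  simp only [iterate_neg_derivation, hDt', hvar, map_sub, map_sum, Finset.mul_sum]
  rw [finsum_sub_distrib hfin_h hfin_sum_sum, finsum_sum_comm _ _ fun α _ => hfin_sum α]
  congr 1
  refine Finset.sum_congr rfl fun α _ => ?_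
  rw [finsum_sum_comm _ _ fun n _ => hfin _ _, finsum_sum_comm _ _ fun n _ => hfin _ _]
  exact Finset.sum_congr rfl fun n _ => finsum_pow_pderiv_iterate_mul hD _ n _ _
end
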